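/- arXiv:2512.11209 — 9 statements merged into one kernel-verified Lean document; each statement's English description precedes it below -/
import Mathlib

section
/- Let X, Y, X', Y' be nonempty finite types, and let f : X → Y and g : X' → Y' be functions. Then there exist functions h : X' → X and k : Y → Y' such that g = k ∘ f ∘ h if and only if the cardinality of the image of g is at most the cardinality of the image of f. (Consequently, convertibility of functions by pre- and post-processing is a total preorder, completely characterized by the single monotone f ↦ |Im(f)|.) -/
/-- For functions `f : X → Y` and `g : X' → Y'` between nonempty finite
types, `g` can be obtained from `f` by a pre-processing `h` and a post-processing `k`
(`g = k ∘ f ∘ h`) if and only if the cardinality of the image of `g` is at most the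
cardinality of the image of `f`. -/
theorem stmt_0 {X Y X' Y' : Type*} [Fintype X] [Fintype Y] [Fintype X'] [Fintype Y']
    [DecidableEq Y] [DecidableEq Y']
    [Nonempty X] [Nonempty Y] [Nonempty X'] [Nonempty Y']
    (f : X → Y) (g : X' → Y') :
    (∃ (h : X' → X) (k : Y → Y'), g = k ∘ f ∘ h) ↔
      (Finset.univ.image g).card ≤ (Finset.univ.image f).card := by
  classical
  constructor
  · rintro ⟨h, k, rfl⟩
    refine le_trans (Finset.card_le_card (t := (Finset.univ.image f).image k) ?_)
      Finset.card_image_le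
    intro y hy
    simp only [Finset.mem_image, Finset.mem_univ, true_and, Function.comp_apply] at hy ⊢
    obtain ⟨x, rfl⟩ := hy
    exact ⟨f (h x), ⟨h x, rfl⟩, rfl⟩
  · intro hc
    have hc' : Fintype.card (Finset.univ.image g) ≤ Fintype.card (Finset.univ.image f) := by
      simpa only [Fintype.card_coe] using hc
    obtain ⟨e⟩ := Function.Embedding.nonempty_of_card_le hc'
    have hf : ∀ y : (Finset.univ.image f), ∃ x, f x = y.1 := by
      intro y
      obtain ⟨x, -, hx⟩ := Finset.mem_image.mp y.2
      exact ⟨x, hx⟩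
    choose s hs using hf
    have hinj : Function.Injective (fun y : (Finset.univ.image g) => (e y).1) :=
      Subtype.val_injective.comp e.injective
    let p : X' → (Finset.univ.image g) :=
      fun x => ⟨g x, Finset.mem_image_of_mem g (Finset.mem_univ x)⟩
    refine ⟨fun x => s (e (p x)), Function.extend (fun y : (Finset.univ.image g) => (e y).1)
      Subtype.val (fun _ => Classical.arbitrary Y'), ?_⟩
    funext x
    simp only [Function.comp_apply, hs]
    exact (hinj.extend_apply Subtype.val _ (p x)).symm
end

section
/- Let P1 be the probability distribution over bit functions assigning weight 1/2 to I and 1/2 to F, and let P2 be the distribution assigning weight 1/2 to I and 1/2 to R0. Then there is no free operation μ with Γ_μ(P1) = P2, and there is no free operation μ with Γ_μ(P2) = P1. Hence the convertibility preorder on probability distributions over bit functions is not a total order. -/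
open Finset

/-- `P` is a probability distribution over the four bit functions. -/
def IsDist (P : (Bool → Bool) → ℝ) : Prop :=
  (∀ f, 0 ≤ P f) ∧ ∑ f : Bool → Bool, P f = 1

/-- `μ` is a probability distribution over pairs (pre-processing, post-processing),
specifying a free operation. -/
def IsFreeOp (μ : ((Bool → Bool) × (Bool → Bool)) → ℝ) : Prop :=
  (∀ gh, 0 ≤ μ gh) ∧ ∑ gh : (Bool → Bool) × (Bool → Bool), μ gh = 1

/-- The action `Γ_μ` of a free operation `μ` on a distribution `P` over bit functions:
`Γ_μ(P)(f') = ∑_{(g,h)} μ(g,h) · ∑_{f : h ∘ f ∘ g = f'} P(f)`. -/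
noncomputable def Gamma (μ : ((Bool → Bool) × (Bool → Bool)) → ℝ)
    (P : (Bool → Bool) → ℝ) : (Bool → Bool) → ℝ :=
  fun f' => ∑ gh : (Bool → Bool) × (Bool → Bool),
    μ gh * ∑ f : Bool → Bool, if gh.2 ∘ f ∘ gh.1 = f' then P f else 0

/-- The identity bit function `I`. -/
def bitI : Bool → Bool := id
/-- The flip bit function `F`. -/
def bitF : Bool → Bool := fun b => !b
/-- The reset-to-zero bit function `R0`. -/
def bitR0 : Bool → Bool := fun _ => false
/-- The reset-to-one bit function `R1`. -/
def bitR1 : Bool → Bool := fun _ => true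

/-- The distribution `½[I] + ½[F]`. -/
noncomputable def Pone : (Bool → Bool) → ℝ :=
  fun f => if f = bitI then 1/2 else if f = bitF then 1/2 else 0

/-- The distribution `½[I] + ½[R0]`. -/
noncomputable def Ptwo : (Bool → Bool) → ℝ :=
  fun f => if f = bitI then 1/2 else if f = bitR0 then 1/2 else 0

theorem sum_two_point (c : (Bool → Bool) → Prop) [DecidablePred c] (a b : Bool → Bool)
    (hab : a ≠ b) :
    (∑ f : Bool → Bool, if c f then
      (if f = a then (1/2 : ℝ) else if f = b then 1/2 else 0) else 0)
    = (if c a then 1/2 else 0) + (if c b then 1/2 else 0) := by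
  have key : ∀ f : Bool → Bool, (if c f then
      (if f = a then (1/2 : ℝ) else if f = b then 1/2 else 0) else 0)
      = (if f = a then (if c a then 1/2 else 0) else 0)
        + (if f = b then (if c b then 1/2 else 0) else 0) := by
    intro f
    by_cases h1 : f = a
    · subst h1; simp [hab]
    · by_cases h2 : f = b
      · subst h2; simp [h1]
      · simp [h1, h2]
  rw [Finset.sum_congr rfl (fun f _ => key f), Finset.sum_add_distrib]
  simp

theorem I_ne_F : bitI ≠ bitF := by decide
theorem I_ne_R0 : bitI ≠ bitR0 := by decide
theorem F_ne_R0 : bitF ≠ bitR0 := by decide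

/-- Flipping the middle function exchanges outcomes `I` and `F`. -/
theorem swap_IF : ∀ g h : Bool → Bool,
    (h ∘ bitI ∘ g = bitI ↔ h ∘ bitF ∘ g = bitF) ∧
    (h ∘ bitF ∘ g = bitI ↔ h ∘ bitI ∘ g = bitF) := by decide

theorem reset_ne : ∀ g h : Bool → Bool,
    h ∘ bitR0 ∘ g ≠ bitI ∧ h ∘ bitR0 ∘ g ≠ bitF := by decide

/-- neither of the two distributions `½[I]+½[F]` and `½[I]+½[R0]`
can be converted to the other by a free operation; hence the convertibility
preorder is not a total order. -/
theorem stmt_1 :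
    (¬ ∃ μ, IsFreeOp μ ∧ Gamma μ Pone = Ptwo) ∧
    (¬ ∃ μ, IsFreeOp μ ∧ Gamma μ Ptwo = Pone) := by
  constructor
  · rintro ⟨μ, -, h⟩
    have e : Gamma μ Pone bitI = Gamma μ Pone bitF := by
      unfold Gamma Pone
      refine Finset.sum_congr rfl fun gh _ => ?_
      rw [sum_two_point _ _ _ I_ne_F, sum_two_point _ _ _ I_ne_F]
      obtain ⟨h1, h2⟩ := swap_IF gh.1 gh.2
      simp only [h1, h2]
      ring
    rw [h] at e
    simp [Ptwo, I_ne_F.symm, F_ne_R0] at e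
  · rintro ⟨μ, ⟨hpos, hsum⟩, h⟩
    have e : Gamma μ Ptwo bitI + Gamma μ Ptwo bitF ≤ 1/2 := by
      have : (1/2 : ℝ) = ∑ gh, μ gh * (1/2) := by rw [← Finset.sum_mul, hsum]; ring
      rw [this]
      unfold Gamma Ptwo
      rw [← Finset.sum_add_distrib]
      refine Finset.sum_le_sum fun gh _ => ?_
      rw [sum_two_point _ _ _ I_ne_R0, sum_two_point _ _ _ I_ne_R0, ← mul_add]
      refine mul_le_mul_of_nonneg_left ?_ (hpos gh)
      obtain ⟨h1, h2⟩ := reset_ne gh.1 gh.2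
      rw [if_neg h1, if_neg h2]
      by_cases h3 : gh.2 ∘ bitI ∘ gh.1 = bitI
      · rw [h3]; simp [I_ne_F]
      · rw [if_neg h3]; split_ifs <;> norm_num
    rw [h] at e
    simp [Pone, I_ne_F.symm] at e
    norm_num at e
end

section
/- For every probability distribution P over bit functions and every free operation μ, writing Q = Γ_μ(P), one has Q(I) + Q(F) ≤ P(I) + P(F). That is, the total weight on the causally connected functions I and F (the monotone M_β) is non-increasing under free operations. -/
open Finset

/-- the weight on the causally connected functions `I` and `F`
(the monotone `M_β`) is non-increasing under free operations. -/
theorem stmt_2 (P : (Bool → Bool) → ℝ) (hP : IsDist P)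
    (μ : ((Bool → Bool) × (Bool → Bool)) → ℝ) (hμ : IsFreeOp μ)
    (Q : (Bool → Bool) → ℝ) (hQ : Q = Gamma μ P) :
    Q bitI + Q bitF ≤ P bitI + P bitF := by
  obtain ⟨hP0, -⟩ := hP
  obtain ⟨hμ0, hμ1⟩ := hμ
  have comb : ∀ g h f : Bool → Bool, (h ∘ f ∘ g = bitI ∨ h ∘ f ∘ g = bitF) →
      (f = bitI ∨ f = bitF) := by decide
  have hne : bitI ≠ bitF := by decide
  -- rewrite the right-hand side as a sum over all bit functions
  have hR : P bitI + P bitF =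
      ∑ f : Bool → Bool, ((if f = bitI then P f else 0) + (if f = bitF then P f else 0)) := by
    rw [Finset.sum_add_distrib]
    simp
  -- the bound for each deterministic free operation
  have key : ∀ gh : (Bool → Bool) × (Bool → Bool),
      (∑ f : Bool → Bool, if gh.2 ∘ f ∘ gh.1 = bitI then P f else 0) +
      (∑ f : Bool → Bool, if gh.2 ∘ f ∘ gh.1 = bitF then P f else 0) ≤ P bitI + P bitF := by
    intro gh
    rw [hR, ← Finset.sum_add_distrib]
    refine Finset.sum_le_sum fun f _ => ?_
    have h0 := hP0 f
    have hc := comb gh.1 gh.2 f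
    by_cases h1 : gh.2 ∘ f ∘ gh.1 = bitI
    · have h2 : gh.2 ∘ f ∘ gh.1 ≠ bitF := fun h => hne (h1.symm.trans h)
      rw [if_pos h1, if_neg h2]
      rcases hc (Or.inl h1) with h | h
      · rw [if_pos h]; split_ifs <;> linarith
      · rw [if_pos h]; split_ifs <;> linarith
    · rw [if_neg h1]
      by_cases h2 : gh.2 ∘ f ∘ gh.1 = bitF
      · rw [if_pos h2]
        rcases hc (Or.inr h2) with h | h
        · rw [if_pos h]; split_ifs <;> linarith
        · rw [if_pos h]; split_ifs <;> linarith
      · rw [if_neg h2]; split_ifs <;> linarith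
  subst hQ
  unfold Gamma
  rw [← Finset.sum_add_distrib]
  calc _ ≤ ∑ gh : (Bool → Bool) × (Bool → Bool), μ gh * (P bitI + P bitF) := by
        refine Finset.sum_le_sum fun gh _ => ?_
        rw [← mul_add]
        exact mul_le_mul_of_nonneg_left (key gh) (hμ0 gh)
    _ = P bitI + P bitF := by rw [← Finset.sum_mul, hμ1, one_mul]
end

section
/- For every probability distribution P over bit functions and every free operation μ, writing Q = Γ_μ(P), one has |Q(I) − Q(F)| · (P(I) + P(F)) ≤ |P(I) − P(F)| · (Q(I) + Q(F)). (This is the cross-multiplied form of the statement that the polarization |α| = |P(I)−P(F)|/(P(I)+P(F)) between the causally connected functions is non-increasing under free operations whenever it is defined, i.e., the monotone M_{|α|}.) -/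
open Finset

lemma univ_bit : (Finset.univ : Finset (Bool → Bool)) = {bitI, bitF, bitR0, bitR1} := by decide

lemma sum_bit (u : (Bool → Bool) → ℝ) :
    ∑ f : Bool → Bool, u f = u bitI + u bitF + u bitR0 + u bitR1 := by
  rw [univ_bit, Finset.sum_insert (by decide), Finset.sum_insert (by decide),
    Finset.sum_insert (by decide), Finset.sum_singleton]
  ring

/-- The inequality for a single deterministic pre/post-processing pair. -/
lemma pair_bound (P : (Bool → Bool) → ℝ) (g h : Bool → Bool) :
    |(∑ f : Bool → Bool, if h ∘ f ∘ g = bitI then P f else 0) -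
      (∑ f : Bool → Bool, if h ∘ f ∘ g = bitF then P f else 0)| * (P bitI + P bitF) ≤
    |P bitI - P bitF| * ((∑ f : Bool → Bool, if h ∘ f ∘ g = bitI then P f else 0) +
      (∑ f : Bool → Bool, if h ∘ f ∘ g = bitF then P f else 0)) := by
  have hg : g ∈ ({bitI, bitF, bitR0, bitR1} : Finset (Bool → Bool)) := by
    rw [← univ_bit]; exact Finset.mem_univ g
  have hh : h ∈ ({bitI, bitF, bitR0, bitR1} : Finset (Bool → Bool)) := by
    rw [← univ_bit]; exact Finset.mem_univ h
  have hc := abs_sub_comm (P bitF) (P bitI)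
  simp only [Finset.mem_insert, Finset.mem_singleton] at hg hh
  rw [sum_bit, sum_bit]
  rcases hg with rfl | rfl | rfl | rfl <;> rcases hh with rfl | rfl | rfl | rfl <;>
    simp +decide only [if_true, if_false, add_zero, zero_add, sub_self, abs_zero, zero_mul,
      mul_zero, le_refl, hc] <;>
    exact le_of_eq (by ring)

/-- cross-multiplied form of the monotonicity of the polarization
`M_{|α|}(P) = |P(I)−P(F)|/(P(I)+P(F))` under free operations. -/
theorem stmt_3 (P : (Bool → Bool) → ℝ) (hP : IsDist P)
    (μ : ((Bool → Bool) × (Bool → Bool)) → ℝ) (hμ : IsFreeOp μ)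
    (Q : (Bool → Bool) → ℝ) (hQ : Q = Gamma μ P) :
    |Q bitI - Q bitF| * (P bitI + P bitF) ≤ |P bitI - P bitF| * (Q bitI + Q bitF) := by
  subst hQ
  have h1 : Gamma μ P bitI - Gamma μ P bitF = ∑ gh : (Bool → Bool) × (Bool → Bool),
      μ gh * ((∑ f : Bool → Bool, if gh.2 ∘ f ∘ gh.1 = bitI then P f else 0) -
        (∑ f : Bool → Bool, if gh.2 ∘ f ∘ gh.1 = bitF then P f else 0)) := by
    simp only [Gamma, mul_sub, Finset.sum_sub_distrib]
  have h2 : Gamma μ P bitI + Gamma μ P bitF = ∑ gh : (Bool → Bool) × (Bool → Bool),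
      μ gh * ((∑ f : Bool → Bool, if gh.2 ∘ f ∘ gh.1 = bitI then P f else 0) +
        (∑ f : Bool → Bool, if gh.2 ∘ f ∘ gh.1 = bitF then P f else 0)) := by
    simp only [Gamma, mul_add, Finset.sum_add_distrib]
  rw [h1, h2]
  refine (mul_le_mul_of_nonneg_right (Finset.abs_sum_le_sum_abs _ _)
    (add_nonneg (hP.1 _) (hP.1 _))).trans ?_
  rw [Finset.sum_mul, Finset.mul_sum]
  refine Finset.sum_le_sum fun gh _ => ?_
  rw [abs_mul, abs_of_nonneg (hμ.1 gh), mul_assoc, mul_left_comm |P bitI - P bitF|]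
  exact mul_le_mul_of_nonneg_left (pair_bound P gh.1 gh.2) (hμ.1 gh)
end

section
/- For a probability distribution P over bit functions, let σ(P) be the distribution obtained from P by swapping the weights assigned to I and F, and let τ(P) be the distribution obtained by swapping the weights assigned to R0 and R1. Then the set {Γ_μ(P) : μ a free operation} (the downward closure of P) equals the convex hull of the six distributions P, σ(P), τ(P), σ(τ(P)), the point distribution on R0, and the point distribution on R1. -/
open Finset

/-- Swap the weights assigned to `I` and `F`. -/
def sigmaSwap (P : (Bool → Bool) → ℝ) : (Bool → Bool) → ℝ :=
  fun f => if f = bitI then P bitF else if f = bitF then P bitI else P f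

/-- Swap the weights assigned to `R0` and `R1`. -/
def tauSwap (P : (Bool → Bool) → ℝ) : (Bool → Bool) → ℝ :=
  fun f => if f = bitR0 then P bitR1 else if f = bitR1 then P bitR0 else P f

/-- The point distribution on a bit function `f0`. -/
noncomputable def pointDist (f0 : Bool → Bool) : (Bool → Bool) → ℝ :=
  fun f => if f = f0 then 1 else 0

theorem sum_bits (G : (Bool → Bool) → ℝ) :
    ∑ f : Bool → Bool, G f = G bitI + G bitF + G bitR0 + G bitR1 := by
  have h : (Finset.univ : Finset (Bool → Bool)) = {bitI, bitF, bitR0, bitR1} := by decide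
  rw [h, Finset.sum_insert (by decide), Finset.sum_insert (by decide),
    Finset.sum_insert (by decide), Finset.sum_singleton]
  ring

theorem bits_cases : ∀ f : Bool → Bool, f = bitI ∨ f = bitF ∨ f = bitR0 ∨ f = bitR1 := by
  decide

theorem ext_bits {P Q : (Bool → Bool) → ℝ} (h1 : P bitI = Q bitI) (h2 : P bitF = Q bitF)
    (h3 : P bitR0 = Q bitR0) (h4 : P bitR1 = Q bitR1) : P = Q := by
  funext f
  rcases bits_cases f with h | h | h | h <;> subst h <;> assumption

/-- The action of a deterministic free operation. -/
noncomputable def detAct (P : (Bool → Bool) → ℝ) (gh : (Bool → Bool) × (Bool → Bool)) :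
    (Bool → Bool) → ℝ :=
  fun f' => ∑ f : Bool → Bool, if gh.2 ∘ f ∘ gh.1 = f' then P f else 0

theorem Gamma_eq (μ : ((Bool → Bool) × (Bool → Bool)) → ℝ) (P : (Bool → Bool) → ℝ) :
    Gamma μ P = ∑ gh, μ gh • detAct P gh := by
  funext f
  simp [Gamma, detAct, Finset.sum_apply]

theorem ne_bits : bitI ≠ bitF ∧ bitI ≠ bitR0 ∧ bitI ≠ bitR1 ∧ bitF ≠ bitI ∧ bitF ≠ bitR0 ∧
    bitF ≠ bitR1 ∧ bitR0 ≠ bitI ∧ bitR0 ≠ bitF ∧ bitR0 ≠ bitR1 ∧ bitR1 ≠ bitI ∧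
    bitR1 ≠ bitF ∧ bitR1 ≠ bitR0 := by decide

theorem bitI_comp (f : Bool → Bool) : bitI ∘ f = f := rfl
theorem comp_bitI (f : Bool → Bool) : f ∘ bitI = f := rfl
theorem bitR0_comp (f : Bool → Bool) : bitR0 ∘ f = bitR0 := rfl
theorem bitR1_comp (f : Bool → Bool) : bitR1 ∘ f = bitR1 := rfl
theorem FF : bitF ∘ bitF = bitI := by decide
theorem FR0 : bitF ∘ bitR0 = bitR1 := by decide
theorem FR1 : bitF ∘ bitR1 = bitR0 := by decide

theorem det_I_I (P : (Bool → Bool) → ℝ) : detAct P (bitI, bitI) = P := by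
  apply ext_bits <;>
    simp [detAct, sum_bits, ne_bits, bitI_comp, comp_bitI, bitR0_comp, bitR1_comp, FF, FR0, FR1]

theorem det_F_I (P : (Bool → Bool) → ℝ) : detAct P (bitF, bitI) = sigmaSwap P := by
  apply ext_bits <;>
    simp [detAct, sigmaSwap, sum_bits, ne_bits, bitI_comp, comp_bitI, bitR0_comp, bitR1_comp,
      FF, FR0, FR1]

theorem det_F_F (P : (Bool → Bool) → ℝ) : detAct P (bitF, bitF) = tauSwap P := by
  apply ext_bits <;>
    simp [detAct, tauSwap, sum_bits, ne_bits, bitI_comp, comp_bitI, bitR0_comp, bitR1_comp,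
      FF, FR0, FR1]

theorem det_I_F (P : (Bool → Bool) → ℝ) :
    detAct P (bitI, bitF) = sigmaSwap (tauSwap P) := by
  apply ext_bits <;>
    simp [detAct, sigmaSwap, tauSwap, sum_bits, ne_bits, bitI_comp, comp_bitI, bitR0_comp,
      bitR1_comp, FF, FR0, FR1]

theorem det_R0 (P : (Bool → Bool) → ℝ) (hP : IsDist P) (g : Bool → Bool) :
    detAct P (g, bitR0) = pointDist bitR0 := by
  have h := hP.2
  funext f
  by_cases e : f = bitR0
  · rw [pointDist, if_pos e, ← h]
    exact Finset.sum_congr rfl fun x _ => if_pos e.symm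
  · rw [pointDist, if_neg e]
    exact Finset.sum_eq_zero fun x _ => if_neg fun e' => e e'.symm

theorem det_R1 (P : (Bool → Bool) → ℝ) (hP : IsDist P) (g : Bool → Bool) :
    detAct P (g, bitR1) = pointDist bitR1 := by
  have h := hP.2
  funext f
  by_cases e : f = bitR1
  · rw [pointDist, if_pos e, ← h]
    exact Finset.sum_congr rfl fun x _ => if_pos e.symm
  · rw [pointDist, if_neg e]
    exact Finset.sum_eq_zero fun x _ => if_neg fun e' => e e'.symm

theorem detAct_nonneg (P : (Bool → Bool) → ℝ) (hP : IsDist P) (gh) (f) :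
    0 ≤ detAct P gh f := by
  refine Finset.sum_nonneg fun x _ => ?_
  split_ifs
  exacts [hP.1 x, le_rfl]

theorem detAct_sum (P : (Bool → Bool) → ℝ) (hP : IsDist P) (gh) :
    ∑ f, detAct P gh f = 1 := by
  simp only [detAct]
  rw [Finset.sum_comm]
  simpa using hP.2

/-- A constant pre-processing gives a mixture of the two resets. -/
theorem det_const (P : (Bool → Bool) → ℝ) (hP : IsDist P) (c : Bool) (h : Bool → Bool)
    (S : Set ((Bool → Bool) → ℝ)) (hS : Convex ℝ S)
    (h0 : pointDist bitR0 ∈ S) (h1 : pointDist bitR1 ∈ S) :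
    detAct P (fun _ => c, h) ∈ S := by
  have hI : detAct P (fun _ => c, h) bitI = 0 := by
    refine Finset.sum_eq_zero fun f _ => if_neg fun e => ?_
    have a := congrFun e true
    have b := congrFun e false
    simp [bitI] at a b
    simp [a] at b
  have hF : detAct P (fun _ => c, h) bitF = 0 := by
    refine Finset.sum_eq_zero fun f _ => if_neg fun e => ?_
    have a := congrFun e true
    have b := congrFun e false
    simp [bitF] at a b
    simp [a] at b
  have hs := detAct_sum P hP (fun _ => c, h)
  rw [sum_bits, hI, hF] at hs
  have := hS h0 h1 (detAct_nonneg P hP (fun _ => c, h) bitR0)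
    (detAct_nonneg P hP (fun _ => c, h) bitR1) (by linarith)
  convert this using 1
  apply ext_bits <;> simp [pointDist, ne_bits, hI, hF]

theorem single_mem (P : (Bool → Bool) → ℝ) (gh : (Bool → Bool) × (Bool → Bool)) :
    ∃ μ, IsFreeOp μ ∧ Gamma μ P = detAct P gh := by
  refine ⟨fun x => if x = gh then 1 else 0, ⟨fun x => ?_, by simp⟩, ?_⟩
  · dsimp only
    split_ifs <;> norm_num
  · simp [Gamma_eq]

/-- the downward closure of `P` under free operations equals the
convex hull of the six distributions `P`, `σ(P)`, `τ(P)`, `σ(τ(P))`, `[R0]`, `[R1]`. -/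
theorem stmt_6 (P : (Bool → Bool) → ℝ) (hP : IsDist P) :
    {Q | ∃ μ, IsFreeOp μ ∧ Gamma μ P = Q} =
      convexHull ℝ
        ({P, sigmaSwap P, tauSwap P, sigmaSwap (tauSwap P),
          pointDist bitR0, pointDist bitR1} : Set ((Bool → Bool) → ℝ)) := by
  apply Set.Subset.antisymm
  · rintro Q ⟨μ, hμ, rfl⟩
    rw [Gamma_eq]
    refine (convex_convexHull ℝ _).sum_mem (fun i _ => hμ.1 i) hμ.2 ?_
    rintro ⟨g, h⟩ -
    have hR0 := det_const P hP false h _ (convex_convexHull ℝ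
        ({P, sigmaSwap P, tauSwap P, sigmaSwap (tauSwap P),
          pointDist bitR0, pointDist bitR1} : Set ((Bool → Bool) → ℝ)))
      (subset_convexHull ℝ _ (by simp)) (subset_convexHull ℝ _ (by simp))
    have hR1 := det_const P hP true h _ (convex_convexHull ℝ
        ({P, sigmaSwap P, tauSwap P, sigmaSwap (tauSwap P),
          pointDist bitR0, pointDist bitR1} : Set ((Bool → Bool) → ℝ)))
      (subset_convexHull ℝ _ (by simp)) (subset_convexHull ℝ _ (by simp))
    rcases bits_cases g with rfl | rfl | rfl | rfl
    · apply subset_convexHull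
      rcases bits_cases h with rfl | rfl | rfl | rfl <;>
        simp [det_I_I, det_I_F, det_R0 P hP, det_R1 P hP]
    · apply subset_convexHull
      rcases bits_cases h with rfl | rfl | rfl | rfl <;>
        simp [det_F_I, det_F_F, det_R0 P hP, det_R1 P hP]
    · exact hR0
    · exact hR1
  · apply convexHull_min
    · rintro Q (rfl | rfl | rfl | rfl | rfl | rfl)
      · simpa [det_I_I] using single_mem Q (bitI, bitI)
      · simpa [det_F_I] using single_mem P (bitF, bitI)
      · simpa [det_F_F] using single_mem P (bitF, bitF)
      · simpa [det_I_F] using single_mem P (bitI, bitF)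
      · simpa [det_R0 P hP] using single_mem P (bitI, bitR0)
      · simpa [det_R1 P hP] using single_mem P (bitI, bitR1)
    · rintro _ ⟨μ, hμ, rfl⟩ _ ⟨ν, hν, rfl⟩ a b ha hb hab
      refine ⟨a • μ + b • ν, ⟨fun x => ?_, ?_⟩, ?_⟩
      · exact add_nonneg (mul_nonneg ha (hμ.1 x)) (mul_nonneg hb (hν.1 x))
      · simp only [Pi.add_apply, Pi.smul_apply, smul_eq_mul]
        rw [Finset.sum_add_distrib, ← Finset.mul_sum, ← Finset.mul_sum, hμ.2, hν.2]
        linarith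
      · simp only [Gamma_eq, Finset.smul_sum, ← Finset.sum_add_distrib]
        refine Finset.sum_congr rfl fun x _ => ?_
        simp only [Pi.add_apply, Pi.smul_apply, add_smul, smul_assoc]
end

section
/- Let X, Y, X', Y' be nonempty finite types, let P be a probability distribution over functions X → Y, let μ be a probability distribution over pairs (g : X' → X, h : Y → Y'), and define Q(f') = ∑_{(g,h)} μ(g,h) · (∑_{f : h ∘ f ∘ g = f'} P(f)) for f' : X' → Y'. Then for every natural number k, ∑_{f' : |Im(f')| ≥ k} Q(f') ≤ ∑_{f : |Im(f)| ≥ k} P(f). That is, each tail sum M_k(P) = ∑_{j ≥ k} β_j(P) of the image-size distribution is a resource monotone. -/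
open Finset

/-- for every `k`, the tail sum of the image-size distribution,
`M_k(P) = ∑_{f : |Im f| ≥ k} P(f)`, is non-increasing under free operations
(probabilistic pre- and post-processings). -/
theorem stmt_10 {X Y X' Y' : Type*} [Fintype X] [Fintype Y] [Fintype X'] [Fintype Y']
    [DecidableEq X] [DecidableEq Y] [DecidableEq X'] [DecidableEq Y']
    [Nonempty X] [Nonempty Y] [Nonempty X'] [Nonempty Y']
    (P : (X → Y) → ℝ) (hP0 : ∀ f, 0 ≤ P f) (hP1 : ∑ f : X → Y, P f = 1)
    (μ : ((X' → X) × (Y → Y')) → ℝ) (hμ0 : ∀ gh, 0 ≤ μ gh)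
    (hμ1 : ∑ gh : (X' → X) × (Y → Y'), μ gh = 1)
    (Q : (X' → Y') → ℝ)
    (hQ : ∀ f', Q f' = ∑ gh : (X' → X) × (Y → Y'),
        μ gh * ∑ f : X → Y, if gh.2 ∘ f ∘ gh.1 = f' then P f else 0)
    (k : ℕ) :
    ∑ f' ∈ Finset.univ.filter (fun f' : X' → Y' => k ≤ (Finset.univ.image f').card), Q f'
      ≤ ∑ f ∈ Finset.univ.filter (fun f : X → Y => k ≤ (Finset.univ.image f).card), P f := by
  simp only [hQ]
  rw [Finset.sum_comm]
  have key : ∀ gh : (X' → X) × (Y → Y'),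
      (∑ f' ∈ Finset.univ.filter (fun f' : X' → Y' => k ≤ (Finset.univ.image f').card),
        μ gh * ∑ f : X → Y, if gh.2 ∘ f ∘ gh.1 = f' then P f else 0)
      ≤ μ gh * ∑ f ∈ Finset.univ.filter
          (fun f : X → Y => k ≤ (Finset.univ.image f).card), P f := by
    intro gh
    rw [← Finset.mul_sum]
    refine mul_le_mul_of_nonneg_left ?_ (hμ0 gh)
    rw [Finset.sum_comm, Finset.sum_filter]
    refine Finset.sum_le_sum fun f _ => ?_
    rw [Finset.sum_ite_eq]
    have hc : (Finset.univ.image (gh.2 ∘ f ∘ gh.1)).card ≤ (Finset.univ.image f).card := by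
      refine le_trans (Finset.card_le_card ?_)
        (Finset.card_image_le (s := Finset.univ.image f) (f := gh.2))
      intro y hy
      obtain ⟨x, -, rfl⟩ := Finset.mem_image.1 hy
      exact Finset.mem_image_of_mem _ (Finset.mem_image_of_mem _ (Finset.mem_univ _))
    by_cases h : k ≤ (Finset.univ.image (gh.2 ∘ f ∘ gh.1)).card
    · rw [if_pos (by simpa using h), if_pos (h.trans hc)]
    · rw [if_neg (by simpa using h)]
      split_ifs
      · exact hP0 f
      · exact le_rfl
  refine (Finset.sum_le_sum fun gh _ => key gh).trans ?_
  rw [← Finset.sum_mul, hμ1, one_mul]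
end

section
/- For every probability distribution P over bit functions and every free operation μ, writing Q = Γ_μ(P), one has |Q(I) − Q(F)| ≤ |P(I) − P(F)|. That is, the absolute value of the Average Causal Effect induced on distributions over functions, ACE_dist(P) = P(I) − P(F), is a resource monotone in the bit-to-bit Resource Theory of Knowledge of Causal Influence. -/
open Finset

/-- Each deterministic free operation either preserves ACE up to sign or sends it to zero. -/
theorem ace_step (P : (Bool → Bool) → ℝ) (g h : Bool → Bool) :
    |(∑ f : Bool → Bool, if h ∘ f ∘ g = bitI then P f else 0) -
      (∑ f : Bool → Bool, if h ∘ f ∘ g = bitF then P f else 0)| ≤ |P bitI - P bitF| := by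
  have key : ∀ g h : Bool → Bool,
      ((∀ f, h ∘ f ∘ g ≠ bitI) ∧ (∀ f, h ∘ f ∘ g ≠ bitF)) ∨
      ((∀ f, h ∘ f ∘ g = bitI ↔ f = bitI) ∧ (∀ f, h ∘ f ∘ g = bitF ↔ f = bitF)) ∨
      ((∀ f, h ∘ f ∘ g = bitI ↔ f = bitF) ∧ (∀ f, h ∘ f ∘ g = bitF ↔ f = bitI)) := by
    decide
  rcases key g h with ⟨h1, h2⟩ | ⟨h1, h2⟩ | ⟨h1, h2⟩
  · simp [h1, h2]
  · simp [h1, h2]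
  · simp [h1, h2, abs_sub_comm]

/-- `|ACE_dist(P)| = |P(I) − P(F)|` is a resource monotone:
it is non-increasing under free operations. -/
theorem stmt_11 (P : (Bool → Bool) → ℝ) (hP : IsDist P)
    (μ : ((Bool → Bool) × (Bool → Bool)) → ℝ) (hμ : IsFreeOp μ)
    (Q : (Bool → Bool) → ℝ) (hQ : Q = Gamma μ P) :
    |Q bitI - Q bitF| ≤ |P bitI - P bitF| := by
  subst hQ
  simp only [Gamma]
  rw [← sum_sub_distrib]
  calc _ ≤ ∑ gh : (Bool → Bool) × (Bool → Bool), μ gh * |P bitI - P bitF| := by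
        refine (abs_sum_le_sum_abs _ _).trans (sum_le_sum fun gh _ => ?_)
        rw [← mul_sub, abs_mul, abs_of_nonneg (hμ.1 gh)]
        exact mul_le_mul_of_nonneg_left (ace_step P gh.1 gh.2) (hμ.1 gh)
    _ = |P bitI - P bitF| := by rw [← sum_mul, hμ.2, one_mul]
end

section
/- Let X and Y be nonempty finite types and let P and P' be probability distributions over functions X → Y with the same image-size profile, i.e., for every natural number k, ∑_{f : |Im(f)| = k} P(f) = ∑_{f : |Im(f)| = k} P'(f). Then there exists a family, indexed by functions f : X → Y, of probability distributions μ_f over pairs (g : X → X, h : Y → Y), such that for every f' : X → Y, ∑_f P(f) · (∑_{(g,h) : h ∘ f ∘ g = f'} μ_f(g,h)) = P'(f'). That is, resources with equal beta vectors are interconvertible under function-dependent pre- and post-processings. -/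
open Finset

theorem exists_processing {X Y : Type*} [Fintype X] [DecidableEq Y] [Nonempty Y]
    (f f' : X → Y) (h : (Finset.univ.image f).card = (Finset.univ.image f').card) :
    ∃ gh : (X → X) × (Y → Y), gh.2 ∘ f ∘ gh.1 = f' := by
  classical
  let e : (Finset.univ.image f) ≃ (Finset.univ.image f') := Finset.equivOfCardEq h
  have hg : ∀ x : X, ∃ z : X, f z = (e.symm ⟨f' x, by simp⟩ : Finset.univ.image f).1 := by
    intro x
    have := (e.symm ⟨f' x, by simp⟩ : Finset.univ.image f).2
    obtain ⟨z, _, hz⟩ := Finset.mem_image.1 this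
    exact ⟨z, hz⟩
  choose g hg using hg
  refine ⟨(g, fun y => if hy : y ∈ Finset.univ.image f then (e ⟨y, hy⟩).1 else y), ?_⟩
  funext x
  have hm : f (g x) ∈ Finset.univ.image f := by simp
  have h2 : (⟨f (g x), hm⟩ : Finset.univ.image f) = e.symm ⟨f' x, by simp⟩ :=
    Subtype.ext (hg x)
  simp only [Function.comp]
  rw [dif_pos hm, h2]
  simp

/-- two probability distributions over functions `X → Y` with the same
image-size profile (beta vector) are interconvertible by function-dependent pre- and
post-processings: there is a family `μ` of distributions over processing pairs, indexed
by the processed function, whose action maps `P` to `P'`. -/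
theorem stmt_15 {X Y : Type*} [Fintype X] [Fintype Y] [DecidableEq X] [DecidableEq Y]
    [Nonempty X] [Nonempty Y]
    (P P' : (X → Y) → ℝ)
    (hP0 : ∀ f, 0 ≤ P f) (hP1 : ∑ f : X → Y, P f = 1)
    (hP'0 : ∀ f, 0 ≤ P' f) (hP'1 : ∑ f : X → Y, P' f = 1)
    (hprofile : ∀ k : ℕ,
      ∑ f ∈ Finset.univ.filter (fun f : X → Y => (Finset.univ.image f).card = k), P f =
      ∑ f ∈ Finset.univ.filter (fun f : X → Y => (Finset.univ.image f).card = k), P' f) :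
    ∃ μ : (X → Y) → ((X → X) × (Y → Y)) → ℝ,
      (∀ f, (∀ gh, 0 ≤ μ f gh) ∧ ∑ gh : (X → X) × (Y → Y), μ f gh = 1) ∧
      ∀ f' : X → Y,
        (∑ f : X → Y, P f * ∑ gh : (X → X) × (Y → Y),
            if gh.2 ∘ f ∘ gh.1 = f' then μ f gh else 0) = P' f' := by
  classical
  have hc : ∀ f f' : X → Y, ∃ gh : (X → X) × (Y → Y),
      (Finset.univ.image f).card = (Finset.univ.image f').card → gh.2 ∘ f ∘ gh.1 = f' := by
    intro f f'
    by_cases h : (Finset.univ.image f).card = (Finset.univ.image f').card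
    · obtain ⟨gh, hgh⟩ := exists_processing f f' h
      exact ⟨gh, fun _ => hgh⟩
    · exact ⟨(id, id), fun h' => absurd h' h⟩
  choose c hc using hc
  let S : (X → Y) → Finset (X → Y) := fun f =>
    Finset.univ.filter (fun f' : X → Y => (Finset.univ.image f').card = (Finset.univ.image f).card)
  let B : (X → Y) → ℝ := fun f => ∑ f' ∈ S f, P' f'
  have hB0 : ∀ f, 0 ≤ B f := fun f => Finset.sum_nonneg fun f' _ => hP'0 f'
  have hBP : ∀ f, ∑ f' ∈ S f, P f' = B f := fun f => hprofile _
  have hself : ∀ f, f ∈ S f := fun f => by simp [S]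
  have hSeq : ∀ f f', f ∈ S f' → S f = S f' := by
    intro f f' h
    simp only [S, Finset.mem_filter, Finset.mem_univ, true_and] at h ⊢
    rw [h]
  let w : (X → Y) → (X → Y) → ℝ := fun f f' =>
    if B f = 0 then (if f' = f then 1 else 0) else (if f' ∈ S f then P' f' / B f else 0)
  have hw0 : ∀ f f', 0 ≤ w f f' := by
    intro f f'
    simp only [w]
    split_ifs
    · exact zero_le_one
    · exact le_rfl
    · exact div_nonneg (hP'0 _) (hB0 _)
    · exact le_rfl
  have hw1 : ∀ f, ∑ f', w f f' = 1 := by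
    intro f
    simp only [w]
    split_ifs with h
    · simp
    · rw [← Finset.sum_filter, Finset.filter_mem_eq_inter, Finset.univ_inter, ← Finset.sum_div]
      exact div_self h
  have hwS : ∀ f f', f' ∉ S f → w f f' = 0 := by
    intro f f' h
    have : f' ≠ f := fun h' => h (h' ▸ hself f)
    simp [w, h, this]
  refine ⟨fun f gh => ∑ f', if c f f' = gh then w f f' else 0, ?_, ?_⟩
  · intro f
    refine ⟨fun gh => Finset.sum_nonneg fun f' _ => ?_, ?_⟩
    · split_ifs
      · exact hw0 _ _
      · exact le_rfl
    · rw [Finset.sum_comm]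
      simpa using hw1 f
  · intro f'
    have key : ∀ f, (∑ gh : (X → X) × (Y → Y), if gh.2 ∘ f ∘ gh.1 = f' then
        (∑ f'', if c f f'' = gh then w f f'' else 0) else 0) = w f f' := by
      intro f
      have h1 : ∀ gh : (X → X) × (Y → Y), (if gh.2 ∘ f ∘ gh.1 = f' then
          (∑ f'', if c f f'' = gh then w f f'' else 0) else 0) =
          ∑ f'', if c f f'' = gh then
            (if (c f f'').2 ∘ f ∘ (c f f'').1 = f' then w f f'' else 0) else 0 := by
        intro gh
        by_cases h : gh.2 ∘ f ∘ gh.1 = f'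
        · rw [if_pos h]
          refine Finset.sum_congr rfl fun f'' _ => ?_
          by_cases h2 : c f f'' = gh
          · rw [if_pos h2, if_pos h2, h2, if_pos h]
          · rw [if_neg h2, if_neg h2]
        · rw [if_neg h]
          symm
          refine Finset.sum_eq_zero fun f'' _ => ?_
          by_cases h2 : c f f'' = gh
          · rw [if_pos h2, h2, if_neg h]
          · rw [if_neg h2]
      rw [Finset.sum_congr rfl fun gh _ => h1 gh, Finset.sum_comm]
      simp only [Finset.sum_ite_eq, Finset.mem_univ, if_true]
      have h3 : ∀ f'', (if (c f f'').2 ∘ f ∘ (c f f'').1 = f' then w f f'' else 0) =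
          if f'' = f' then w f f'' else 0 := by
        intro f''
        by_cases h : f'' ∈ S f
        · have h4 : (Finset.univ.image f).card = (Finset.univ.image f'').card := by
            simpa [S] using (Finset.mem_filter.1 h).2.symm
          rw [hc f f'' h4]
        · simp [hwS f f'' h]
      rw [Finset.sum_congr rfl fun f'' _ => h3 f'']
      simp
    rw [Finset.sum_congr rfl fun f _ => by rw [key f]]
    have hsymm : ∀ f, f ∉ S f' → f' ∉ S f := by
      intro f h h'
      exact h (hSeq _ _ h' ▸ hself f)
    have hres : ∑ f, P f * w f f' = ∑ f ∈ S f', P f * w f f' := by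
      symm
      refine Finset.sum_subset (Finset.subset_univ _) fun f _ h => ?_
      rw [hwS _ _ (hsymm f h), mul_zero]
    rw [hres]
    by_cases hB : B f' = 0
    · have hP'z : P' f' = 0 :=
        (Finset.sum_eq_zero_iff_of_nonneg fun i _ => hP'0 i).1 hB f' (hself f')
      have hPz := (Finset.sum_eq_zero_iff_of_nonneg fun i _ => hP0 i).1 ((hBP f').trans hB)
      rw [hP'z]
      exact Finset.sum_eq_zero fun f hf => by rw [hPz f hf, zero_mul]
    · have h5 : ∀ f ∈ S f', P f * w f f' = P f * (P' f' / B f') := by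
        intro f hf
        have h6 : S f = S f' := hSeq f f' hf
        have h7 : B f = B f' := by simp only [B, h6]
        simp only [w]
        rw [h7, if_neg hB, h6, if_pos (hself f')]
      rw [Finset.sum_congr rfl h5, ← Finset.sum_mul, hBP]
      field_simp
end

section
/- Let X and Y be nonempty finite types and let Γ be the map sending a probability distribution P over functions X → Y to the stochastic map Γ(P)(y|x) = ∑_{f : f(x) = y} P(f). Then Γ is injective if and only if X has exactly one element or Y has exactly one element. -/
open Finset

lemma marg_aux {X Y : Type*} [Fintype X] [Fintype Y] [DecidableEq X] [DecidableEq Y]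
    (a b : X → Y) (x : X) (y : Y) :
    (∑ f : X → Y, if f x = y then
      ((if f = a then (1/2 : ℝ) else 0) + (if f = b then (1/2 : ℝ) else 0)) else 0)
    = (if a x = y then (1/2 : ℝ) else 0) + (if b x = y then (1/2 : ℝ) else 0) := by
  have h : ∀ f : X → Y, (if f x = y then
      ((if f = a then (1/2 : ℝ) else 0) + (if f = b then (1/2 : ℝ) else 0)) else 0)
      = (if f = a then (if a x = y then (1/2 : ℝ) else 0) else 0)
        + (if f = b then (if b x = y then (1/2 : ℝ) else 0) else 0) := by
    intro f
    by_cases h1 : f = a <;> by_cases h2 : f = b <;> by_cases h3 : f x = y <;> simp_all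
  rw [Finset.sum_congr rfl (fun f _ => h f), Finset.sum_add_distrib]
  simp

/-- the map `Γ` sending a probability distribution over functions
`X → Y` to its induced stochastic map `Γ(P)(y|x) = ∑_{f : f(x)=y} P(f)` is injective
(on probability distributions) if and only if `X` or `Y` has exactly one element. -/
theorem stmt_17 {X Y : Type*} [Fintype X] [Fintype Y] [DecidableEq X] [DecidableEq Y]
    [Nonempty X] [Nonempty Y] :
    (∀ P P' : (X → Y) → ℝ,
        (∀ f, 0 ≤ P f) → (∑ f : X → Y, P f = 1) →
        (∀ f, 0 ≤ P' f) → (∑ f : X → Y, P' f = 1) →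
        (∀ x y, (∑ f : X → Y, if f x = y then P f else 0)
              = ∑ f : X → Y, if f x = y then P' f else 0) →
        P = P') ↔
      (Fintype.card X = 1 ∨ Fintype.card Y = 1) := by
  constructor
  · intro H
    by_contra hc
    rw [not_or] at hc
    have hX : 1 < Fintype.card X := by
      have := Fintype.card_pos (α := X)
      omega
    have hY : 1 < Fintype.card Y := by
      have := Fintype.card_pos (α := Y)
      omega
    obtain ⟨x0, x1, hx⟩ := Fintype.one_lt_card_iff.mp hX
    obtain ⟨y0, y1, hy⟩ := Fintype.one_lt_card_iff.mp hY
    let a : X → Y := fun _ => y0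
    let b : X → Y := fun _ => y1
    let c : X → Y := fun x => if x = x0 then y1 else y0
    let d : X → Y := fun x => if x = x0 then y0 else y1
    have key := H
      (fun f => (if f = a then (1/2 : ℝ) else 0) + (if f = b then (1/2 : ℝ) else 0))
      (fun f => (if f = c then (1/2 : ℝ) else 0) + (if f = d then (1/2 : ℝ) else 0))
      (fun f => by positivity)
      (by rw [Finset.sum_add_distrib]; simp; norm_num)
      (fun f => by positivity)
      (by rw [Finset.sum_add_distrib]; simp; norm_num)
      (by
        intro x y
        rw [marg_aux, marg_aux]
        by_cases h : x = x0
        · simp only [a, b, c, d, h, if_true]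
          rw [add_comm]
        · simp only [a, b, c, d, h, if_false])
    have hab : a ≠ b := fun h => hy (congrFun h x0)
    have hac : a ≠ c := fun h => hy (by simpa [a, c] using congrFun h x0)
    have had : a ≠ d := fun h => hy (by simpa [a, d, hx.symm] using congrFun h x1)
    have := congrFun key a
    simp [hab, hac, had] at this
  · rintro (h | h) P P' _ h1 _ h2 hm
    · obtain ⟨x0, hx0⟩ := Fintype.card_eq_one_iff.mp h
      funext g
      have hg : ∀ f : X → Y, f x0 = g x0 ↔ f = g := by
        intro f
        refine ⟨fun e => ?_, fun e => by rw [e]⟩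
        funext x
        rw [hx0 x, e]
      simpa [hg] using hm x0 (g x0)
    · obtain ⟨y0, hy0⟩ := Fintype.card_eq_one_iff.mp h
      funext g
      have hg : ∀ f : X → Y, f = g := fun f => by
        funext x
        rw [hy0 (f x), hy0 (g x)]
      rw [Fintype.sum_eq_single g (fun f hf => absurd (hg f) hf)] at h1 h2
      rw [h1, h2]
end
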